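/- For every κ ∈ ℝ, the function Z(x) = κ·(x²/2)·V₀'(x) satisfies Z''(x) + exp(V₀(x))·Z(x) = κ·V₀'(x) − 2κ·x·exp(V₀(x)) for all x ∈ ℝ. -/

import Mathlib

noncomputable def V₀ (x : ℝ) : ℝ :=
  Real.log (4 * Real.exp (Real.sqrt 2 * x) / (1 + Real.exp (Real.sqrt 2 * x)) ^ 2)

lemma V₀_hasDerivAt (x : ℝ) : HasDerivAt V₀
    (Real.sqrt 2 * (1 - Real.exp (Real.sqrt 2 * x)) / (1 + Real.exp (Real.sqrt 2 * x))) x := by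
  have h1 : HasDerivAt (fun y : ℝ => Real.exp (Real.sqrt 2 * y))
      (Real.exp (Real.sqrt 2 * x) * (Real.sqrt 2 * 1)) x :=
    ((hasDerivAt_id x).const_mul (Real.sqrt 2)).exp
  have hpos := Real.exp_pos (Real.sqrt 2 * x)
  have hne : 1 + Real.exp (Real.sqrt 2 * x) ≠ 0 := by positivity
  have h2 := ((h1.const_mul 4).div ((h1.const_add 1).pow 2) (pow_ne_zero 2 hne)).log
    (by simp only [Pi.div_apply, Pi.pow_apply]; positivity)
  refine HasDerivAt.congr_deriv (f := V₀) h2 ?_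
  simp only [Pi.div_apply, Pi.pow_apply]
  field_simp
  ring

lemma exp_V₀ (x : ℝ) : Real.exp (V₀ x) =
    4 * Real.exp (Real.sqrt 2 * x) / (1 + Real.exp (Real.sqrt 2 * x)) ^ 2 := by
  unfold V₀
  exact Real.exp_log (by positivity)

lemma deriv_V₀_hasDerivAt (x : ℝ) : HasDerivAt (deriv V₀) (-Real.exp (V₀ x)) x := by
  have e : deriv V₀ = fun x => Real.sqrt 2 * (1 - Real.exp (Real.sqrt 2 * x)) /
      (1 + Real.exp (Real.sqrt 2 * x)) := funext fun x => (V₀_hasDerivAt x).deriv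
  rw [e, exp_V₀]
  have h1 : HasDerivAt (fun y : ℝ => Real.exp (Real.sqrt 2 * y))
      (Real.exp (Real.sqrt 2 * x) * (Real.sqrt 2 * 1)) x :=
    ((hasDerivAt_id x).const_mul (Real.sqrt 2)).exp
  have hne : 1 + Real.exp (Real.sqrt 2 * x) ≠ 0 := by positivity
  refine (((h1.const_sub 1).const_mul (Real.sqrt 2)).div (h1.const_add 1) hne).congr_deriv ?_
  have hs : Real.sqrt 2 ^ 2 = 2 := Real.sq_sqrt (by norm_num)
  rw [← neg_div]
  congr 1
  linear_combination (-2 * Real.exp (Real.sqrt 2 * x)) * hs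

theorem stmt_10 (κ : ℝ) :
    ∀ x : ℝ,
      deriv (deriv (fun y : ℝ => κ * (y ^ 2 / 2) * deriv V₀ y)) x +
          Real.exp (V₀ x) * (κ * (x ^ 2 / 2) * deriv V₀ x) =
        κ * deriv V₀ x - 2 * κ * x * Real.exp (V₀ x) := by
  have hq (y : ℝ) : HasDerivAt (fun y : ℝ => κ * (y ^ 2 / 2)) (κ * y) y := by
    refine ((((hasDerivAt_id y).pow 2).div_const 2).const_mul κ).congr_deriv ?_
    simp
  have hZ : deriv (fun y : ℝ => κ * (y ^ 2 / 2) * deriv V₀ y) =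
      fun y => κ * y * deriv V₀ y + κ * (y ^ 2 / 2) * (-Real.exp (V₀ y)) :=
    funext fun y => ((hq y).mul (deriv_V₀_hasDerivAt y)).deriv
  intro x
  have hV : HasDerivAt V₀ (deriv V₀ x) x := (V₀_hasDerivAt x).differentiableAt.hasDerivAt
  have hl : HasDerivAt (fun y : ℝ => κ * y) (κ * 1) x := (hasDerivAt_id x).const_mul κ
  have hZ2 : HasDerivAt
      (fun y => κ * y * deriv V₀ y + κ * (y ^ 2 / 2) * (-Real.exp (V₀ y))) _ x :=
    (hl.mul (deriv_V₀_hasDerivAt x)).add ((hq x).mul hV.exp.neg)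
  rw [hZ, hZ2.deriv]
  ring
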